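/- Let k = ⊕_{i≤0} k^i be a bounded-below acyclic differential graded Lie algebra over a field of characteristic zero, with differential ∂ of degree +1, and let X be an even central cocycle. Then any two odd solutions f, f' ∈ k⁻ of the equation ∂f + (1/2)[f,f] = X are gauge equivalent: there exists an even element s ∈ k⁻ with f' = e^{ad_s} f - j^R(ad_s) ∂s, where j^R(z) = (e^z - 1)/z. -/

import Mathlib

set_option maxHeartbeats 1000000
set_option synthInstance.maxHeartbeats 400000

noncomputable section

/-- A differential graded Lie algebra over `𝕜`, concentrated in non-positive degrees and
bounded below, presented internally: `K` is the underlying space, `piece i` its degree-`i`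
component, `br` the (graded) Lie bracket and `d` the differential of degree `+1`, which is a
derivation of the bracket; the sign axioms are imposed on homogeneous elements. -/
structure NegDGLA (𝕜 K : Type*) [Field 𝕜] [AddCommGroup K] [Module 𝕜 K] where
  piece : ℤ → Submodule 𝕜 K
  internal : DirectSum.IsInternal piece
  bounded : ∃ N : ℤ, ∀ i < N, piece i = ⊥
  nonpos : ∀ i > 0, piece i = ⊥
  br : K →ₗ[𝕜] K →ₗ[𝕜] K
  d : Module.End 𝕜 K
  br_grade : ∀ i j x y, x ∈ piece i → y ∈ piece j → br x y ∈ piece (i + j)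
  d_grade : ∀ i x, x ∈ piece i → d x ∈ piece (i + 1)
  d_sq : d ∘ₗ d = 0
  skew : ∀ i j x y, x ∈ piece i → y ∈ piece j →
    br x y = -(((-1 : 𝕜) ^ (i * j)) • br y x)
  jacobi : ∀ i j x y z, x ∈ piece i → y ∈ piece j →
    br x (br y z) = br (br x y) z + ((-1 : 𝕜) ^ (i * j)) • br y (br x z)
  leibniz : ∀ i x y, x ∈ piece i →
    d (br x y) = br (d x) y + ((-1 : 𝕜) ^ i) • br x (d y)

namespace NegDGLA

variable {𝕜 K : Type*} [Field 𝕜] [AddCommGroup K] [Module 𝕜 K] (D : NegDGLA 𝕜 K)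

/-- The even part `⊕_i k^{2i}`. -/
def evenPart : Submodule 𝕜 K := ⨆ i : ℤ, D.piece (2 * i)

/-- The odd part of `k⁻ = ⊕_{i<0} k^i`. -/
def oddNeg : Submodule 𝕜 K := ⨆ (i : ℤ) (_ : i < 0) (_ : Odd i), D.piece i

/-- The even part of `k⁻ = ⊕_{i<0} k^i`. -/
def evenNeg : Submodule 𝕜 K := ⨆ (i : ℤ) (_ : i < 0) (_ : Even i), D.piece i

/-- The center of `k`: elements bracketing to zero with everything. -/
def center : Submodule 𝕜 K := ⨅ y : K, LinearMap.ker (D.br.flip y)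

end NegDGLA

section Helpers

open Finset

/-- Iterated Leibniz rule for a bilinear map, on an invariant submodule. -/
theorem NegDGLA.leibniz_iter {𝕜 E K : Type*} [Field 𝕜] [AddCommGroup E] [Module 𝕜 E]
    [AddCommGroup K] [Module 𝕜 K] (B : E →ₗ[𝕜] E →ₗ[𝕜] K) (A : Module.End 𝕜 E)
    (L : Module.End 𝕜 K) (S : Submodule 𝕜 E) (hA : ∀ u ∈ S, A u ∈ S)
    (hL : ∀ u ∈ S, ∀ v ∈ S, L (B u v) = B (A u) v + B u (A v))
    (u v : E) (hu : u ∈ S) (hv : v ∈ S) (n : ℕ) :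
    (L ^ n) (B u v) =
      ∑ ij ∈ antidiagonal n, n.choose ij.1 • B ((A ^ ij.1) u) ((A ^ ij.2) v) := by
  have hS : ∀ (n : ℕ) (w : E), w ∈ S → (A ^ n) w ∈ S := by
    intro n w hw
    induction n with
    | zero => simpa using hw
    | succ k ih => rw [pow_succ', Module.End.mul_apply]; exact hA _ ih
  induction n with
  | zero => simp
  | succ n ih =>
    rw [Finset.sum_antidiagonal_choose_succ_nsmul
      (fun i j ↦ B ((A ^ i) u) ((A ^ j) v)) n]
    rw [pow_succ', Module.End.mul_apply, ih, map_sum, ← sum_add_distrib]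
    refine sum_congr rfl ?_
    rintro ⟨i, j⟩ hij
    rw [HasAntidiagonal.mem_antidiagonal] at hij
    rw [Nat.choose_symm_of_eq_add hij.symm, map_nsmul, hL _ (hS i u hu) _ (hS j v hv), add_comm,
      nsmul_add]
    simp only [pow_succ', Module.End.mul_apply]

theorem NegDGLA.exp_invariant {𝕜 E K : Type*} [Field 𝕜] [CharZero 𝕜] [AddCommGroup E]
    [Module 𝕜 E]
    [AddCommGroup K] [Module 𝕜 K] (B : E →ₗ[𝕜] E →ₗ[𝕜] K) (A : Module.End 𝕜 E)
    (L : Module.End 𝕜 K) (S : Submodule 𝕜 E) (hA : ∀ u ∈ S, A u ∈ S)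
    (hL : ∀ u ∈ S, ∀ v ∈ S, L (B u v) = B (A u) v + B u (A v))
    (u : E) (hu : u ∈ S) (h0 : L (B u u) = 0) (N : ℕ) (hN : ∀ n, N ≤ n → (A ^ n) u = 0)
    (w : E) (hw : w = ∑ i ∈ range N, (i.factorial : 𝕜)⁻¹ • (A ^ i) u) :
    B w w = B u u := by
  rcases Nat.eq_zero_or_pos N with h | hpos
  · have := hN 0 (by omega)
    simp at this
    subst h
    simp [hw, this]
  set h : ℕ × ℕ → K := fun p ↦ (p.1.factorial : 𝕜)⁻¹ • (p.2.factorial : 𝕜)⁻¹ •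
    B ((A ^ p.1) u) ((A ^ p.2) u) with hh
  have e1 : B w w = ∑ p ∈ range N ×ˢ range N, h p := by
    rw [hw, sum_product]
    simp only [map_sum, LinearMap.sum_apply, map_smul, LinearMap.smul_apply, hh, smul_sum]
    rw [sum_comm]
    refine sum_congr rfl fun i _ ↦ sum_congr rfl fun j _ ↦ ?_
    rw [smul_comm]
  have e2 : ∑ p ∈ range N ×ˢ range N, h p = ∑ n ∈ range (2 * N), ∑ p ∈ antidiagonal n, h p := by
    rw [← sum_fiberwise_of_maps_to (s := range N ×ˢ range N) (t := range (2 * N))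
      (g := fun p ↦ p.1 + p.2)]
    · refine sum_congr rfl fun n _ ↦ ?_
      refine sum_subset ?_ ?_
      · intro p hp
        simp at hp ⊢
        exact hp.2
      · intro p hp hp'
        simp at hp hp'
        simp only [hh]
        by_cases h1 : p.1 < N
        · have h2 : N ≤ p.2 := by
            by_contra h3
            exact hp' h1 (by omega) hp
          rw [hN _ h2]; simp
        · rw [hN _ (not_lt.1 h1)]; simp
    · intro p hp
      simp at hp ⊢
      omega
  have e3 : ∀ n, ∑ p ∈ antidiagonal n, h p = (n.factorial : 𝕜)⁻¹ • (L ^ n) (B u u) := by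
    intro n
    rw [NegDGLA.leibniz_iter B A L S hA hL u u hu hu n, smul_sum]
    refine sum_congr rfl ?_
    rintro ⟨i, j⟩ hij
    rw [HasAntidiagonal.mem_antidiagonal] at hij
    simp only [hh]
    simp only at hij
    subst hij
    rw [← Nat.cast_smul_eq_nsmul 𝕜, smul_smul, smul_smul]
    congr 1
    have hc := Nat.add_choose_mul_factorial_mul_factorial i j
    have hc' : ((i + j).choose i : 𝕜) * (i.factorial : 𝕜) * (j.factorial : 𝕜)
      = ((i + j).factorial : 𝕜) := by
      rw [Nat.choose_symm_add]; exact_mod_cast hc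
    have a1 : (i.factorial : 𝕜) ≠ 0 := by exact_mod_cast i.factorial_ne_zero
    have a2 : (j.factorial : 𝕜) ≠ 0 := by exact_mod_cast j.factorial_ne_zero
    have a3 : ((i + j).factorial : 𝕜) ≠ 0 := by exact_mod_cast (i + j).factorial_ne_zero
    field_simp
    rw [← hc']; ring
  rw [e1, e2, sum_congr rfl (fun n _ ↦ e3 n)]
  rw [sum_eq_single 0]
  · simp
  · intro n _ hn
    obtain ⟨m, rfl⟩ := Nat.exists_eq_succ_of_ne_zero hn
    rw [pow_succ, Module.End.mul_apply, h0]; simp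
  · intro hx; simp at hx; omega

namespace NegDGLA

variable {𝕜 K : Type*} [Field 𝕜] [AddCommGroup K] [Module 𝕜 K] (D : NegDGLA 𝕜 K)

/-- Sum of the pieces whose degree satisfies `P`. -/
def V (P : ℤ → Prop) : Submodule 𝕜 K := ⨆ (i : ℤ) (_ : P i), D.piece i

theorem V_le {P : ℤ → Prop} {W : Submodule 𝕜 K} (h : ∀ i, P i → D.piece i ≤ W) : D.V P ≤ W :=
  iSup₂_le h

theorem mem_V {P : ℤ → Prop} {i : ℤ} {x : K} (hx : x ∈ D.piece i) (h : P i) : x ∈ D.V P :=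
  (le_iSup₂_of_le (f := fun (i : ℤ) (_ : P i) ↦ D.piece i) i h le_rfl) hx

theorem V_mono {P Q : ℤ → Prop} (h : ∀ i, P i → Q i) : D.V P ≤ D.V Q :=
  D.V_le fun _ hi _ hx ↦ D.mem_V hx (h _ hi)

theorem oddNeg_eq : D.oddNeg = D.V (fun i ↦ i ≤ -1 ∧ i % 2 = 1) := by
  apply le_antisymm
  · exact iSup_le fun i ↦ iSup_le fun h ↦ iSup_le fun h' x hx ↦
      D.mem_V hx ⟨by omega, Int.odd_iff.1 h'⟩
  · refine D.V_le fun i hi ↦ ?_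
    exact le_iSup_of_le i (le_iSup_of_le (by omega) (le_iSup_of_le (Int.odd_iff.2 hi.2) le_rfl))

theorem evenNeg_eq : D.evenNeg = D.V (fun i ↦ i ≤ -2 ∧ i % 2 = 0) := by
  apply le_antisymm
  · exact iSup_le fun i ↦ iSup_le fun h ↦ iSup_le fun h' x hx ↦
      D.mem_V hx (by have := Int.even_iff.1 h'; omega)
  · refine D.V_le fun i hi ↦ ?_
    exact le_iSup_of_le i (le_iSup_of_le (by omega) (le_iSup_of_le (Int.even_iff.2 hi.2) le_rfl))

theorem V_top {P : ℤ → Prop} (h : ∀ i ≤ 0, P i) : D.V P = ⊤ := by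
  rw [eq_top_iff, ← D.internal.submodule_iSup_eq_top]
  refine iSup_le fun i ↦ ?_
  by_cases hi : i ≤ 0
  · exact fun x hx ↦ D.mem_V hx (h i hi)
  · rw [D.nonpos i (by omega)]; exact bot_le

theorem br_V {P Q R : ℤ → Prop} (h : ∀ i j, P i → Q j → R (i + j)) {x y : K}
    (hx : x ∈ D.V P) (hy : y ∈ D.V Q) : D.br x y ∈ D.V R := by
  have h1 : D.V P ≤ (D.V R).comap (D.br.flip y) := by
    refine D.V_le fun i hi x hx ↦ ?_
    have h2 : D.V Q ≤ (D.V R).comap (D.br x) :=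
      D.V_le fun j hj y hy ↦ D.mem_V (D.br_grade i j x y hx hy) (h i j hi hj)
    exact h2 hy
  exact h1 hx

theorem d_V {P R : ℤ → Prop} (h : ∀ i, P i → R (i + 1)) {x : K}
    (hx : x ∈ D.V P) : D.d x ∈ D.V R := by
  have h1 : D.V P ≤ (D.V R).comap D.d :=
    D.V_le fun i hi x hx ↦ D.mem_V (D.d_grade i x hx) (h i hi)
  exact h1 hx

theorem jacobi_even {s : K} (hs : s ∈ D.V (fun i ↦ i % 2 = 0)) (y z : K) :
    D.br s (D.br y z) = D.br (D.br s y) z + D.br y (D.br s z) := by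
  have hy : y ∈ D.V (fun _ ↦ True) := by rw [D.V_top (by simp)]; trivial
  have h1 : D.V (fun i ↦ i % 2 = 0) ≤ LinearMap.ker
      (D.br.flip (D.br y z) - (D.br.flip z) ∘ₗ (D.br.flip y) - (D.br y) ∘ₗ (D.br.flip z)) := by
    refine D.V_le fun i hi s hs ↦ ?_
    have h2 : D.V (fun _ ↦ True) ≤ LinearMap.ker
      ((D.br s) ∘ₗ (D.br.flip z) - (D.br.flip z) ∘ₗ (D.br s) - D.br.flip (D.br s z)) := by
      refine D.V_le fun j _ y hy ↦ ?_
      have := D.jacobi i j s y z hs hy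
      rw [Even.neg_one_zpow ((Int.even_iff.2 hi).mul_right j), one_smul] at this
      simp [this]
    have := h2 hy
    simpa using this
  have := h1 hs
  simp [sub_sub, sub_eq_zero] at this
  exact this

theorem leibniz_even {s : K} (hs : s ∈ D.V (fun i ↦ i % 2 = 0)) (y : K) :
    D.d (D.br s y) = D.br (D.d s) y + D.br s (D.d y) := by
  have h1 : D.V (fun i ↦ i % 2 = 0) ≤ LinearMap.ker
      (D.d ∘ₗ D.br.flip y - (D.br.flip y) ∘ₗ D.d - (D.br.flip (D.d y))) := by
    refine D.V_le fun i hi s hs ↦ ?_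
    have := D.leibniz i s y hs
    rw [Even.neg_one_zpow (Int.even_iff.2 hi), one_smul] at this
    simp [this]
  have := h1 hs
  simp [sub_sub, sub_eq_zero] at this
  exact this

theorem skew_odd {x y : K} (hx : x ∈ D.V (fun i ↦ i % 2 = 1)) (hy : y ∈ D.V (fun i ↦ i % 2 = 1)) :
    D.br x y = D.br y x := by
  have h1 : D.V (fun i ↦ i % 2 = 1) ≤ LinearMap.ker (D.br.flip y - D.br y) := by
    refine D.V_le fun i hi x hx ↦ ?_
    have h2 : D.V (fun i ↦ i % 2 = 1) ≤ LinearMap.ker (D.br x - D.br.flip x) := by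
      refine D.V_le fun j hj y hy ↦ ?_
      have := D.skew i j x y hx hy
      rw [Odd.neg_one_zpow ((Int.odd_iff.2 hi).mul (Int.odd_iff.2 hj))] at this
      simp [this]
    have := h2 hy
    simpa [sub_eq_zero] using this
  have := h1 hx
  simpa [sub_eq_zero] using this

theorem skew_even {x : K} (hx : x ∈ D.V (fun i ↦ i % 2 = 0)) (y : K) :
    D.br x y = - D.br y x := by
  have hy : y ∈ D.V (fun _ ↦ True) := by rw [D.V_top (by simp)]; trivial
  have h1 : D.V (fun i ↦ i % 2 = 0) ≤ LinearMap.ker (D.br.flip y + D.br y) := by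
    refine D.V_le fun i hi x hx ↦ ?_
    have h2 : D.V (fun _ ↦ True) ≤ LinearMap.ker (D.br x + D.br.flip x) := by
      refine D.V_le fun j _ y hy ↦ ?_
      have := D.skew i j x y hx hy
      rw [Even.neg_one_zpow ((Int.even_iff.2 hi).mul_right j), one_smul] at this
      simp [this]
    have := h2 hy
    simpa using this
  have := h1 hx
  exact eq_neg_of_add_eq_zero_left (by simpa using this)

/-- Existence of component projections. -/
theorem exists_proj : ∃ π : ℤ → Module.End 𝕜 K,
    (∀ i x, π i x ∈ D.piece i) ∧ (∀ i, ∀ x ∈ D.piece i, π i x = x) ∧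
    (∀ i j, ∀ x ∈ D.piece j, i ≠ j → π i x = 0) := by
  classical
  let _ := D.internal.chooseDecomposition
  refine ⟨fun i ↦ (D.piece i).subtype ∘ₗ (DirectSum.component 𝕜 ℤ (fun i ↦ D.piece i) i) ∘ₗ
    (DirectSum.decomposeLinearEquiv D.piece).toLinearMap, ?_, ?_, ?_⟩
  · intro i x
    simp
  · intro i x hx
    exact DirectSum.decompose_of_mem_same D.piece hx
  · intro i j x hx hij
    exact DirectSum.decompose_of_mem_ne D.piece hx hij.symm

theorem br_pow_V {P Q : ℤ → Prop} (h : ∀ i j, P i → Q j → Q (i + j)) {s x : K}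
    (hs : s ∈ D.V P) (hx : x ∈ D.V Q) (n : ℕ) :
    ((D.br s : Module.End 𝕜 K) ^ n) x ∈ D.V Q := by
  induction n with
  | zero => simpa using hx
  | succ n ih => rw [pow_succ', Module.End.mul_apply]; exact D.br_V h hs ih

theorem V_bot : ∃ M : ℕ, ∀ P : ℤ → Prop, (∀ i, P i → i ≤ -(M : ℤ)) → D.V P = ⊥ := by
  obtain ⟨N, hN⟩ := D.bounded
  refine ⟨(-N + 1).toNat, fun P hP ↦ ?_⟩
  rw [eq_bot_iff]
  refine D.V_le fun i hi ↦ ?_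
  have := hP i hi
  rw [hN i (by omega)]

theorem nilp : ∃ N : ℕ, 0 < N ∧ ∀ s ∈ D.V (fun i ↦ i ≤ -2 ∧ i % 2 = 0),
    (D.br s : Module.End 𝕜 K) ^ N = 0 := by
  obtain ⟨M, hM⟩ := D.V_bot
  refine ⟨M + 1, by omega, fun s hs ↦ ?_⟩
  have key : ∀ (n : ℕ) (x : K),
      ((D.br s : Module.End 𝕜 K) ^ n) x ∈ D.V (fun i ↦ i ≤ -(n : ℤ)) := by
    intro n x
    induction n with
    | zero => rw [D.V_top (by simp)]; trivial
    | succ n ih =>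
      rw [pow_succ', Module.End.mul_apply]
      refine D.br_V ?_ hs ih
      intro i j hi hj
      push_cast
      omega
  ext x
  have := key (M + 1) x
  rw [hM _ (fun i hi ↦ by push_cast at hi; omega)] at this
  simpa using this

/-- Truncated gauge action. -/
def act (N : ℕ) (s f : K) : K :=
  (∑ i ∈ Finset.range N, (i.factorial : 𝕜)⁻¹ • (D.br s : Module.End 𝕜 K) ^ i) f
    - (∑ i ∈ Finset.range N, ((i + 1).factorial : 𝕜)⁻¹ • (D.br s : Module.End 𝕜 K) ^ i) (D.d s)

theorem act_odd {s f : K} (N : ℕ) (hs : s ∈ D.V (fun i ↦ i ≤ -2 ∧ i % 2 = 0))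
    (hf : f ∈ D.V (fun i ↦ i ≤ -1 ∧ i % 2 = 1)) :
    D.act N s f ∈ D.V (fun i ↦ i ≤ -1 ∧ i % 2 = 1) := by
  have hds : D.d s ∈ D.V (fun i ↦ i ≤ -1 ∧ i % 2 = 1) := D.d_V (fun i hi ↦ by omega) hs
  unfold act
  simp only [LinearMap.sum_apply, LinearMap.smul_apply]
  refine Submodule.sub_mem _ (Submodule.sum_mem _ fun i _ ↦ Submodule.smul_mem _ _ ?_)
    (Submodule.sum_mem _ fun i _ ↦ Submodule.smul_mem _ _ ?_)
  · exact D.br_pow_V (fun i j hi hj ↦ by omega) hs hf i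
  · exact D.br_pow_V (fun i j hi hj ↦ by omega) hs hds i

theorem act_mc [CharZero 𝕜] {s f X : K} (N : ℕ) (hs : s ∈ D.V (fun i ↦ i ≤ -2 ∧ i % 2 = 0))
    (hN : (D.br s : Module.End 𝕜 K) ^ N = 0)
    (hf : f ∈ D.V (fun i ↦ i ≤ -1 ∧ i % 2 = 1)) (hX : D.br s X = 0)
    (hsol : D.d f + (2 : 𝕜)⁻¹ • D.br f f = X) :
    D.d (D.act N s f) + (2 : 𝕜)⁻¹ • D.br (D.act N s f) (D.act N s f) = X := by
  have hse : s ∈ D.V (fun i ↦ i % 2 = 0) := D.V_mono (fun i hi ↦ hi.2) hs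
  have hfo : f ∈ D.V (fun i ↦ i % 2 = 1) := D.V_mono (fun i hi ↦ hi.2) hf
  have hdso : D.d s ∈ D.V (fun i ↦ i % 2 = 1) := D.d_V (fun i hi ↦ by omega) hse
  let fs := LinearMap.fst 𝕜 𝕜 K
  let sn := LinearMap.snd 𝕜 𝕜 K
  let B : (𝕜 × K) →ₗ[𝕜] (𝕜 × K) →ₗ[𝕜] K :=
    LinearMap.mk₂ 𝕜 (fun u v ↦ u.1 • D.d v.2 + v.1 • D.d u.2 + D.br u.2 v.2)
      (by intro u u' v; simp [add_smul]; abel) (by intro c u v; simp [smul_smul, mul_comm])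
      (by intro u u' v; simp [add_smul]; abel) (by intro c u v; simp [smul_smul, mul_comm])
  have hB : ∀ u v, B u v = u.1 • D.d v.2 + v.1 • D.d u.2 + D.br u.2 v.2 := fun u v ↦ rfl
  let A : Module.End 𝕜 (𝕜 × K) :=
    LinearMap.inr 𝕜 𝕜 K ∘ₗ ((D.br s) ∘ₗ sn - fs.smulRight (D.d s))
  have hA : ∀ u, A u = (0, D.br s u.2 - u.1 • D.d s) := fun u ↦ rfl
  let S : Submodule 𝕜 (𝕜 × K) := (D.V (fun i ↦ i % 2 = 1)).comap sn
  have hApow : ∀ n, (A ^ (n + 1)) (1, f) = (0, ((D.br s : Module.End 𝕜 K) ^ (n + 1)) f -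
      ((D.br s : Module.End 𝕜 K) ^ n) (D.d s)) := by
    intro n
    induction n with
    | zero => simp [hA]
    | succ n ih =>
      rw [pow_succ', Module.End.mul_apply, ih, hA]
      simp only [pow_succ', Module.End.mul_apply, map_sub, zero_smul, sub_zero]
  have hpow0 : ∀ n, N ≤ n → (D.br s : Module.End 𝕜 K) ^ n = 0 := fun n hn ↦
    pow_eq_zero_of_le hn hN
  have hmain := NegDGLA.exp_invariant B A (D.br s) S
    (by
      intro u hu
      change (A u).2 ∈ D.V _
      rw [hA]
      exact Submodule.sub_mem _ (D.br_V (fun i j hi hj ↦ by omega) hse hu)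
        (Submodule.smul_mem _ _ hdso))
    (by
      intro u hu v hv
      have hu' : u.2 ∈ D.V (fun i ↦ i % 2 = 1) := hu
      rw [hB, hB, hB, hA, hA]
      have e : D.d (D.d s) = 0 := LinearMap.congr_fun D.d_sq s
      simp only [map_add, map_sub, map_smul, D.jacobi_even hse, D.leibniz_even hse, e,
        LinearMap.sub_apply, LinearMap.smul_apply, zero_smul, smul_zero, sub_zero,
        D.skew_odd hu' hdso, smul_add]
      abel)
    (1, f) (show f ∈ D.V _ from hfo)
    (by
      have : B (1, f) (1, f) = (2 : 𝕜) • X := by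
        rw [hB, ← hsol]; simp [two_smul, smul_smul]
      rw [this, map_smul, hX, smul_zero])
    (N + 1)
    (by
      intro n hn
      obtain ⟨m, rfl⟩ := Nat.exists_eq_succ_of_ne_zero (show n ≠ 0 by omega)
      rw [hApow, hpow0 _ (by omega), hpow0 _ (by omega)]; simp)
    (1, D.act N s f)
    (by
      rw [Finset.sum_range_succ']
      simp only [hApow]
      unfold act
      have hN' : ∑ i ∈ Finset.range N, (i.factorial : 𝕜)⁻¹ • (D.br s : Module.End 𝕜 K) ^ i
        = ∑ i ∈ Finset.range (N + 1), (i.factorial : 𝕜)⁻¹ • (D.br s : Module.End 𝕜 K) ^ i := by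
        rw [Finset.sum_range_succ, hN]; simp
      rw [hN', Finset.sum_range_succ']
      ext
      · simp [Prod.fst_sum]
      · simp [Prod.snd_sum, smul_sub, Finset.sum_sub_distrib]
        abel)
  rw [hB, hB] at hmain
  simp only [one_smul] at hmain
  have h2 : (2 : 𝕜) ≠ 0 := two_ne_zero
  have h3 : ∀ g : K, D.d g + (2 : 𝕜)⁻¹ • D.br g g
      = (2 : 𝕜)⁻¹ • (D.d g + D.d g + D.br g g) := by
    intro g
    rw [← two_smul 𝕜 (D.d g), smul_add, smul_smul, inv_mul_cancel₀ h2, one_smul]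
  rw [h3, hmain, ← h3, hsol]

theorem pow_diff {s t x : K} (k : ℤ) (hk : 1 ≤ k) (hs : s ∈ D.V (fun i ↦ i ≤ -2 ∧ i % 2 = 0))
    (ht : t ∈ D.V (fun i ↦ i ≤ -k - 1 ∧ i % 2 = 0)) (hkodd : k % 2 = 1)
    (hx : x ∈ D.V (fun i ↦ i ≤ -1 ∧ i % 2 = 1)) (n : ℕ) :
    ((D.br (s + t) : Module.End 𝕜 K) ^ n) x - ((D.br s : Module.End 𝕜 K) ^ n) x
      ∈ D.V (fun i ↦ i ≤ -k - 2 ∧ i % 2 = 1) := by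
  have hst : s + t ∈ D.V (fun i ↦ i ≤ -2 ∧ i % 2 = 0) :=
    Submodule.add_mem _ hs (D.V_mono (fun i hi ↦ by omega) ht)
  induction n with
  | zero => simp
  | succ n ih =>
    rw [pow_succ', pow_succ', Module.End.mul_apply, Module.End.mul_apply]
    have e : D.br (s + t) (((D.br (s + t) : Module.End 𝕜 K) ^ n) x)
        - D.br s (((D.br s : Module.End 𝕜 K) ^ n) x)
        = D.br (s + t) (((D.br (s + t) : Module.End 𝕜 K) ^ n) x
            - ((D.br s : Module.End 𝕜 K) ^ n) x)
          + D.br t (((D.br s : Module.End 𝕜 K) ^ n) x) := by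
      have e' : ∀ y, D.br t y = D.br (s + t) y - D.br s y := by
        intro y
        rw [map_add, LinearMap.add_apply, add_sub_cancel_left]
      rw [map_sub, e']
      abel
    rw [e]
    have hb := D.br_pow_V (fun i j hi hj ↦ by omega) hs hx n
    exact Submodule.add_mem _ (D.br_V (fun i j hi hj ↦ by omega) hst ih)
      (D.br_V (fun i j hi hj ↦ by omega) ht hb)

theorem act_diff {s t f : K} (N : ℕ) (hN : 0 < N) (k : ℤ) (hk : 1 ≤ k)
    (hs : s ∈ D.V (fun i ↦ i ≤ -2 ∧ i % 2 = 0))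
    (ht : t ∈ D.V (fun i ↦ i ≤ -k - 1 ∧ i % 2 = 0)) (hkodd : k % 2 = 1)
    (hf : f ∈ D.V (fun i ↦ i ≤ -1 ∧ i % 2 = 1)) :
    D.act N (s + t) f - D.act N s f + D.d t ∈ D.V (fun i ↦ i ≤ -k - 2 ∧ i % 2 = 1) := by
  have hst : s + t ∈ D.V (fun i ↦ i ≤ -2 ∧ i % 2 = 0) :=
    Submodule.add_mem _ hs (D.V_mono (fun i hi ↦ by omega) ht)
  have hds : D.d s ∈ D.V (fun i ↦ i ≤ -1 ∧ i % 2 = 1) := D.d_V (fun i hi ↦ by omega) hs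
  have hdt : D.d t ∈ D.V (fun i ↦ i ≤ -k ∧ i % 2 = 1) := D.d_V (fun i hi ↦ by omega) ht
  obtain ⟨M, rfl⟩ := Nat.exists_eq_succ_of_ne_zero hN.ne'
  have e : D.act (M + 1) (s + t) f - D.act (M + 1) s f + D.d t =
      (∑ i ∈ Finset.range (M + 1), (i.factorial : 𝕜)⁻¹ •
        (((D.br (s + t) : Module.End 𝕜 K) ^ i) f - ((D.br s : Module.End 𝕜 K) ^ i) f))
      - (∑ i ∈ Finset.range (M + 1), ((i + 1).factorial : 𝕜)⁻¹ •
        (((D.br (s + t) : Module.End 𝕜 K) ^ i) (D.d s) - ((D.br s : Module.End 𝕜 K) ^ i) (D.d s)))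
      - (∑ i ∈ Finset.range M, ((i + 1 + 1).factorial : 𝕜)⁻¹ •
        ((D.br (s + t) : Module.End 𝕜 K) ^ (i + 1)) (D.d t)) := by
    have e1 : (∑ i ∈ Finset.range M, ((i + 1 + 1).factorial : 𝕜)⁻¹ •
        ((D.br (s + t) : Module.End 𝕜 K) ^ (i + 1)) (D.d t)) =
        (∑ i ∈ Finset.range (M + 1), ((i + 1).factorial : 𝕜)⁻¹ •
        ((D.br (s + t) : Module.End 𝕜 K) ^ i) (D.d t)) - D.d t := by
      rw [Finset.sum_range_succ' _ M]
      simp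
    rw [e1]
    unfold act
    rw [map_add D.d s t]
    simp only [map_add (∑ i ∈ Finset.range (M + 1), _), LinearMap.sum_apply, LinearMap.smul_apply,
      smul_sub, Finset.sum_sub_distrib]
    abel
  rw [e]
  refine Submodule.sub_mem _ (Submodule.sub_mem _
    (Submodule.sum_mem _ fun i _ ↦ Submodule.smul_mem _ _ ?_)
    (Submodule.sum_mem _ fun i _ ↦ Submodule.smul_mem _ _ ?_))
    (Submodule.sum_mem _ fun i _ ↦ Submodule.smul_mem _ _ ?_)
  · exact D.pow_diff k hk hs ht hkodd hf i
  · exact D.pow_diff k hk hs ht hkodd hds i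
  · rw [pow_succ', Module.End.mul_apply]
    have hb := D.br_pow_V (fun i j hi hj ↦ by omega) hst hdt i
    exact D.br_V (fun i j hi hj ↦ by omega) hst hb

/-- One step: the leading term of the difference of two solutions is exact. -/
theorem step (hacyclic : LinearMap.ker D.d ≤ LinearMap.range D.d) {X g f' : K} (k : ℤ)
    (hg : g ∈ D.V (fun i ↦ i ≤ -1 ∧ i % 2 = 1)) (hf' : f' ∈ D.V (fun i ↦ i ≤ -1 ∧ i % 2 = 1))
    (hsol : D.d g + (2 : 𝕜)⁻¹ • D.br g g = X)
    (hsol' : D.d f' + (2 : 𝕜)⁻¹ • D.br f' f' = X) (hkodd : k % 2 = 1)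
    (hδ : g - f' ∈ D.V (fun i ↦ i ≤ -k ∧ i % 2 = 1)) :
    ∃ t ∈ D.V (fun i ↦ i ≤ -k - 1 ∧ i % 2 = 0),
      g - f' - D.d t ∈ D.V (fun i ↦ i ≤ -k - 2 ∧ i % 2 = 1) := by
  obtain ⟨π, h1, h2, h3⟩ := D.exists_proj
  have hall : ∀ x : K, x ∈ D.V (fun _ ↦ True) := by intro x; rw [D.V_top (by simp)]; trivial
  have hπd : ∀ i x, π (i + 1) (D.d x) = D.d (π i x) := by
    intro i x
    have : D.V (fun _ ↦ True) ≤ LinearMap.ker (π (i + 1) ∘ₗ D.d - D.d ∘ₗ π i) := by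
      refine D.V_le fun j _ y hy ↦ ?_
      have hdy := D.d_grade j y hy
      by_cases hij : i = j
      · subst hij
        simp [h2 _ _ hy, h2 _ _ hdy]
      · simp [h3 i j y hy hij, h3 (i + 1) (j + 1) _ hdy (by omega)]
    have := this (hall x)
    simpa [sub_eq_zero] using this
  have hπV : ∀ (P : ℤ → Prop) (i : ℤ), ¬ P i → ∀ x ∈ D.V P, π i x = 0 := by
    intro P i hi x hx
    have : D.V P ≤ LinearMap.ker (π i) :=
      D.V_le fun j hj y hy ↦ h3 i j y hy (by rintro rfl; exact hi hj)
    exact this hx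
  set δ := g - f' with hδdef
  have hbr : D.br g g - D.br f' f' = D.br δ g + D.br f' δ := by
    simp [hδdef]
  have heq : D.d δ + (2 : 𝕜)⁻¹ • (D.br δ g + D.br f' δ) = 0 := by
    rw [← hbr, hδdef, map_sub, smul_sub]
    rw [← sub_eq_zero.2 (hsol.trans hsol'.symm)]
    abel
  have hbrV : D.br δ g + D.br f' δ ∈ D.V (fun i ↦ i ≤ -k - 1) :=
    Submodule.add_mem _ (D.br_V (fun i j hi hj ↦ by omega) hδ hg)
      (D.br_V (fun i j hi hj ↦ by omega) hf' hδ)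
  have hd0 : D.d (π (-k) δ) = 0 := by
    have := congrArg (π (-k + 1)) heq
    rw [map_add, map_smul, hπV _ _ (by omega) _ hbrV, hπd] at this
    simpa using this
  obtain ⟨t', ht'⟩ := hacyclic (show π (-k) δ ∈ LinearMap.ker D.d from hd0)
  have hdt : D.d (π (-k - 1) t') = π (-k) δ := by
    rw [← hπd, ht']
    rw [show -k - 1 + 1 = -k by ring]
    exact h2 _ _ (h1 _ _)
  refine ⟨π (-k - 1) t', D.mem_V (h1 _ _) (by omega), ?_⟩
  rw [hdt]
  have : D.V (fun i ↦ i ≤ -k ∧ i % 2 = 1) ≤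
      (D.V (fun i ↦ i ≤ -k - 2 ∧ i % 2 = 1)).comap (LinearMap.id - π (-k)) := by
    refine D.V_le fun i hi y hy ↦ ?_
    by_cases hik : -k = i
    · subst hik
      simp [h2 _ _ hy]
    · have : y ∈ D.V (fun i ↦ i ≤ -k - 2 ∧ i % 2 = 1) := D.mem_V hy (by omega)
      simpa [h3 _ _ _ hy hik] using this
  exact this hδ

end NegDGLA

end Helpers

/-- In a bounded-below acyclic differential graded Lie algebra concentrated in non-positive
degrees, any two odd solutions `f, f' ∈ k⁻` of `∂f + ½[f,f] = X`, for `X` an even central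
cocycle, are gauge equivalent: `f' = e^{ad_s} f - j^R(ad_s) ∂s` for some even `s ∈ k⁻`,
where `j^R(z) = (e^z - 1)/z = Σ_i z^i/(i+1)!` (the operator `ad_s` being nilpotent, these
power series are the finite sums truncated at `N` with `ad_s^N = 0`). -/
theorem mc_solutions_gauge_equivalent {𝕜 K : Type*} [Field 𝕜] [CharZero 𝕜]
    [AddCommGroup K] [Module 𝕜 K] (D : NegDGLA 𝕜 K)
    (hacyclic : LinearMap.ker D.d ≤ LinearMap.range D.d)
    (X : K) (hXeven : X ∈ D.evenPart) (hXcentral : X ∈ D.center) (hXcocycle : D.d X = 0)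
    (f f' : K) (hf : f ∈ D.oddNeg) (hf' : f' ∈ D.oddNeg)
    (hsol : D.d f + (2 : 𝕜)⁻¹ • D.br f f = X)
    (hsol' : D.d f' + (2 : 𝕜)⁻¹ • D.br f' f' = X) :
    ∃ s ∈ D.evenNeg, ∃ N : ℕ, ∃ ads : Module.End 𝕜 K, ads = D.br s ∧ ads ^ N = 0 ∧
      f' = (∑ i ∈ Finset.range N, (i.factorial : 𝕜)⁻¹ • ads ^ i) f
        - (∑ i ∈ Finset.range N, ((i + 1).factorial : 𝕜)⁻¹ • ads ^ i) (D.d s) := by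
  rw [D.oddNeg_eq] at hf hf'
  rw [D.evenNeg_eq]
  obtain ⟨N, hNpos, hN⟩ := D.nilp
  have hXc : ∀ y, D.br X y = 0 := by
    intro y
    have := (Submodule.mem_iInf _).1 hXcentral y
    simpa using this
  have hsX : ∀ s ∈ D.V (fun i ↦ i ≤ -2 ∧ i % 2 = 0), D.br s X = 0 := by
    intro s hs
    rw [D.skew_even (D.V_mono (fun i hi ↦ hi.2) hs), hXc, neg_zero]
  have main : ∀ k : ℕ, ∃ s ∈ D.V (fun i ↦ i ≤ -2 ∧ i % 2 = 0),
      D.act N s f - f' ∈ D.V (fun i ↦ i ≤ -(2 * (k : ℤ) + 1) ∧ i % 2 = 1) := by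
    intro k
    induction k with
    | zero =>
      refine ⟨0, Submodule.zero_mem _, ?_⟩
      have e : D.act N 0 f = f := by
        unfold NegDGLA.act
        obtain ⟨M, rfl⟩ := Nat.exists_eq_succ_of_ne_zero hNpos.ne'
        rw [Finset.sum_range_succ']
        simp
      rw [e]
      simpa using Submodule.sub_mem _ hf hf'
    | succ k ih =>
      obtain ⟨s, hs, hδ⟩ := ih
      have hmc := D.act_mc N hs (hN s hs) hf (hsX s hs) hsol
      obtain ⟨t, ht, hδt⟩ := D.step hacyclic (2 * (k : ℤ) + 1) (D.act_odd N hs hf) hf' hmc hsol'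
        (by omega) hδ
      refine ⟨s + t, Submodule.add_mem _ hs (D.V_mono (fun i hi ↦ by omega) ht), ?_⟩
      have hdiff := D.act_diff N hNpos (2 * (k : ℤ) + 1) (by omega) hs ht (by omega) hf
      have hsum := Submodule.add_mem _ hdiff hδt
      have e : D.act N (s + t) f - f' = D.act N (s + t) f - D.act N s f + D.d t
          + (D.act N s f - f' - D.d t) := by abel
      rw [e]
      exact D.V_mono (fun i hi ↦ by push_cast; omega) hsum
  obtain ⟨M, hM⟩ := D.V_bot
  obtain ⟨s, hs, h⟩ := main M
  rw [hM _ (fun i hi ↦ by omega), Submodule.mem_bot, sub_eq_zero] at h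
  exact ⟨s, hs, N, D.br s, rfl, hN s hs, h.symm⟩
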